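/- Let p be an odd prime and let D = {(x, y) ∈ ℚ_p² : x = 0 or x² = y²}. Then for every s ∈ ℂ with −1 < Re(s) < 1/2, the function (x, y) ↦ |(x² − y²)/x²|_p^s is integrable on ℤ_p² ∖ D, and ∫_{ℤ_p² ∖ D} |(x² − y²)/x²|_p^s dμ(x, y) = (p^{1+s} + p²·(p − 2)·p^{−s} + p^{2−2s} − 2p + 1)/((p + 1)·(p^{1+s} − 1)·(p^{1−2s} − 1)). -/

import Mathlib

open MeasureTheory Complex

namespace PadicZeta

section Field

variable {p : ℕ} [hpp : Fact p.Prime]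

theorem exists_norm_eq_inv_pow {x : ℚ_[p]} (hx : x ≠ 0) (h : ‖x‖ ≤ 1) :
    ∃ n : ℕ, ‖x‖ = (p : ℝ)⁻¹ ^ n := by
  obtain ⟨x, rfl⟩ : ∃ y : ℤ_[p], (y : ℚ_[p]) = x := ⟨⟨x, h⟩, rfl⟩
  refine ⟨x.valuation, ?_⟩
  have := PadicInt.norm_eq_zpow_neg_valuation (x := x) fun h0 => hx (by simp [h0])
  rw [PadicInt.norm_def] at this
  simpa using this

theorem exists_digit {x : ℚ_[p]} {n : ℕ} (h : ‖x‖ ≤ (p : ℝ)⁻¹ ^ n) :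
    ∃ i < p, ‖x - (i : ℚ_[p]) * (p : ℚ_[p]) ^ n‖ ≤ (p : ℝ)⁻¹ ^ (n + 1) := by
  have hp0 : (p : ℚ_[p]) ≠ 0 := by exact_mod_cast hpp.out.ne_zero
  have hpr : (0 : ℝ) < p := by exact_mod_cast hpp.out.pos
  have hy : ‖x / (p : ℚ_[p]) ^ n‖ ≤ 1 := by
    rw [norm_div, norm_pow, Padic.norm_p]
    exact div_le_one_of_le₀ h (by positivity)
  obtain ⟨y, hy⟩ : ∃ y : ℤ_[p], (y : ℚ_[p]) = x / (p : ℚ_[p]) ^ n := ⟨⟨_, hy⟩, rfl⟩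
  obtain ⟨i, hi, hm⟩ := PadicInt.exists_mem_range y
  refine ⟨i, hi, ?_⟩
  rw [PadicInt.maximalIdeal_eq_span_p] at hm
  have h1 := (PadicInt.norm_le_pow_iff_mem_span_pow _ 1).2 (by simpa using hm)
  rw [PadicInt.norm_def] at h1
  have h2 : x - (i : ℚ_[p]) * (p : ℚ_[p]) ^ n
      = (x / (p : ℚ_[p]) ^ n - i) * (p : ℚ_[p]) ^ n := by field_simp
  rw [h2, norm_mul, norm_pow, Padic.norm_p, pow_succ, mul_comm]
  gcongr
  simpa [← hy] using h1

theorem digit_unique {x : ℚ_[p]} {n i j : ℕ} (hi : i < p) (hj : j < p)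
    (h1 : ‖x - (i : ℚ_[p]) * (p : ℚ_[p]) ^ n‖ ≤ (p : ℝ)⁻¹ ^ (n + 1))
    (h2 : ‖x - (j : ℚ_[p]) * (p : ℚ_[p]) ^ n‖ ≤ (p : ℝ)⁻¹ ^ (n + 1)) : i = j := by
  have hp1 : (1 : ℝ) < p := by exact_mod_cast hpp.out.one_lt
  have h3 : ‖(((i : ℤ) - (j : ℤ) : ℤ) : ℚ_[p])‖ * (p : ℝ)⁻¹ ^ n ≤ (p : ℝ)⁻¹ * (p : ℝ)⁻¹ ^ n := by
    rw [← pow_succ']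
    calc _ = ‖(x - (j : ℚ_[p]) * (p : ℚ_[p]) ^ n) - (x - (i : ℚ_[p]) * (p : ℚ_[p]) ^ n)‖ := by
          rw [← Padic.norm_p, ← norm_pow, ← norm_mul]
          congr 1
          push_cast
          ring
      _ ≤ _ := by
        rw [sub_eq_add_neg]
        refine (IsUltrametricDist.norm_add_le_max _ _).trans (max_le h2 ?_)
        rwa [norm_neg]
  have h4 := le_of_mul_le_mul_right h3 (by positivity)
  have h5 := (Padic.norm_intCast_lt_one_iff).1 (h4.trans_lt (inv_lt_one_of_one_lt₀ hp1))
  have h6 := Int.eq_zero_of_abs_lt_dvd h5 (by rw [abs_lt]; constructor <;> omega)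
  omega

theorem norm_eq_inv_pow_iff {x : ℚ_[p]} {n : ℕ} :
    ‖x‖ = (p : ℝ)⁻¹ ^ n ↔ ‖x‖ ≤ (p : ℝ)⁻¹ ^ n ∧ ¬ ‖x‖ ≤ (p : ℝ)⁻¹ ^ (n + 1) := by
  have h := Padic.norm_le_pow_iff_norm_lt_pow_add_one x (-((n + 1 : ℕ) : ℤ))
  have h' : -((n + 1 : ℕ) : ℤ) + 1 = -(n : ℤ) := by push_cast; ring
  rw [h', zpow_neg, zpow_neg, zpow_natCast, zpow_natCast, ← inv_pow, ← inv_pow] at h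
  rw [h, not_lt, le_antisymm_iff]

end Field

section Measure

variable {p : ℕ} [hpp : Fact p.Prime] {V : Type*} [AddCommGroup V] [Module ℚ_[p] V]
  [MeasurableSpace V] [MeasurableAdd V] {μ : Measure V} [μ.IsAddLeftInvariant]

theorem measure_ball_inter (u v : V →ₗ[ℚ_[p]] ℚ_[p]) (hu : Measurable fun z => ‖u z‖)
    (hv : Measurable fun z => ‖v z‖) {e : V} (hue : u e = 1) (hve : v e = 0) (n : ℕ) (r : ℝ) :
    μ {z | ‖u z‖ ≤ (p : ℝ)⁻¹ ^ n ∧ ‖v z‖ ≤ r} =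
      p * μ {z | ‖u z‖ ≤ (p : ℝ)⁻¹ ^ (n + 1) ∧ ‖v z‖ ≤ r} := by
  have hpr : (1 : ℝ) < p := by exact_mod_cast hpp.out.one_lt
  set S : Set V := {z | ‖u z‖ ≤ (p : ℝ)⁻¹ ^ (n + 1) ∧ ‖v z‖ ≤ r} with hS
  have hSm : MeasurableSet S :=
    (measurableSet_le hu measurable_const).inter (measurableSet_le hv measurable_const)
  let c : ℕ → V := fun i => -(((i : ℚ_[p]) * (p : ℚ_[p]) ^ n) • e)
  have huc : ∀ i z, u (c i + z) = u z - (i : ℚ_[p]) * (p : ℚ_[p]) ^ n := by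
    intro i z
    simp [c, hue, sub_eq_neg_add]
  have hvc : ∀ i z, v (c i + z) = v z := by
    intro i z
    simp [c, hve]
  have hU : {z | ‖u z‖ ≤ (p : ℝ)⁻¹ ^ n ∧ ‖v z‖ ≤ r} =
      ⋃ i ∈ Finset.range p, (fun z => c i + z) ⁻¹' S := by
    ext z
    simp only [hS, Set.mem_ofPred_eq, Set.mem_iUnion, Set.mem_preimage, huc, hvc, Finset.mem_range,
      exists_prop]
    constructor
    · rintro ⟨h1, h2⟩
      obtain ⟨i, hi, h⟩ := exists_digit h1
      exact ⟨i, hi, h, h2⟩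
    · rintro ⟨i, -, h1, h2⟩
      refine ⟨?_, h2⟩
      have h3 : u z = (u z - (i : ℚ_[p]) * (p : ℚ_[p]) ^ n) + ((i : ℤ) : ℚ_[p]) * (p : ℚ_[p]) ^ n := by
        push_cast
        ring
      rw [h3]
      refine (IsUltrametricDist.norm_add_le_max _ _).trans (max_le (h1.trans ?_) ?_)
      · exact pow_le_pow_of_le_one (by positivity) (inv_le_one_of_one_le₀ hpr.le) n.le_succ
      · rw [norm_mul, norm_pow, Padic.norm_p]
        exact mul_le_of_le_one_left (by positivity) (Padic.norm_int_le_one _)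
  rw [hU, measure_biUnion_finset]
  · simp [measure_preimage_add]
  · intro i hi j hj hij
    refine Set.disjoint_left.2 fun z h1 h2 => hij ?_
    simp only [hS, Set.mem_preimage, Set.mem_ofPred_eq, huc] at h1 h2
    exact digit_unique (by simpa using hi) (by simpa using hj) h1.1 h2.1
  · exact fun i _ => measurable_const_add _ hSm

theorem measureReal_box (u v : V →ₗ[ℚ_[p]] ℚ_[p]) (hu : Measurable fun z => ‖u z‖)
    (hv : Measurable fun z => ‖v z‖) {e₁ e₂ : V} (hue : u e₁ = 1) (hve : v e₁ = 0)
    (hue' : u e₂ = 0) (hve' : v e₂ = 1) (h1 : μ {z | ‖u z‖ ≤ 1 ∧ ‖v z‖ ≤ 1} = 1) (a b : ℕ) :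
    μ.real {z | ‖u z‖ ≤ (p : ℝ)⁻¹ ^ a ∧ ‖v z‖ ≤ (p : ℝ)⁻¹ ^ b} =
      (p : ℝ)⁻¹ ^ a * (p : ℝ)⁻¹ ^ b := by
  have hpr : (p : ℝ) ≠ 0 := by exact_mod_cast hpp.out.ne_zero
  induction a with
  | zero =>
    induction b with
    | zero => simp [measureReal_def, h1]
    | succ b ih =>
      have := congrArg ENNReal.toReal
        (measure_ball_inter (μ := μ) v u hv hu hve' hue' b ((p : ℝ)⁻¹ ^ 0))
      simp only [and_comm (a := ‖v _‖ ≤ _), ENNReal.toReal_mul, ENNReal.toReal_natCast] at this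
      simp only [measureReal_def] at ih ⊢
      rw [ih] at this
      exact ((eq_inv_mul_iff_mul_eq₀ hpr).2 this.symm).trans (by ring)
  | succ a ih =>
    have := congrArg ENNReal.toReal
      (measure_ball_inter (μ := μ) u v hu hv hue hve a ((p : ℝ)⁻¹ ^ b))
    simp only [ENNReal.toReal_mul, ENNReal.toReal_natCast] at this
    simp only [measureReal_def] at ih ⊢
    rw [ih] at this
    exact ((eq_inv_mul_iff_mul_eq₀ hpr).2 this.symm).trans (by ring)

theorem measureReal_annulus (u v : V →ₗ[ℚ_[p]] ℚ_[p]) (hu : Measurable fun z => ‖u z‖)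
    (hv : Measurable fun z => ‖v z‖) {e₁ e₂ : V} (hue : u e₁ = 1) (hve : v e₁ = 0)
    (hue' : u e₂ = 0) (hve' : v e₂ = 1) (h1 : μ {z | ‖u z‖ ≤ 1 ∧ ‖v z‖ ≤ 1} = 1) (a b : ℕ) :
    μ.real {z | ‖u z‖ = (p : ℝ)⁻¹ ^ a ∧ ‖v z‖ = (p : ℝ)⁻¹ ^ b} =
      (1 - (p : ℝ)⁻¹) ^ 2 * ((p : ℝ)⁻¹ ^ a * (p : ℝ)⁻¹ ^ b) := by
  have hpr : (p : ℝ) ≠ 0 := by exact_mod_cast hpp.out.ne_zero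
  have hq : (p : ℝ)⁻¹ ≤ 1 := Nat.cast_inv_le_one p
  have hbox := measureReal_box (μ := μ) u v hu hv hue hve hue' hve' h1
  have hfin : ∀ a b : ℕ, μ {z | ‖u z‖ ≤ (p : ℝ)⁻¹ ^ a ∧ ‖v z‖ ≤ (p : ℝ)⁻¹ ^ b} ≠ ⊤ := by
    intro a b h
    have := hbox a b
    rw [measureReal_def, h, ENNReal.toReal_top] at this
    exact (by positivity : (p : ℝ)⁻¹ ^ a * (p : ℝ)⁻¹ ^ b ≠ 0) this.symm
  have hpow : ∀ n : ℕ, (p : ℝ)⁻¹ ^ (n + 1) ≤ (p : ℝ)⁻¹ ^ n := fun n =>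
    pow_le_pow_of_le_one (by positivity) hq n.le_succ
  have hhalf : ∀ b : ℕ, μ.real {z | ‖u z‖ = (p : ℝ)⁻¹ ^ a ∧ ‖v z‖ ≤ (p : ℝ)⁻¹ ^ b} =
      (1 - (p : ℝ)⁻¹) * ((p : ℝ)⁻¹ ^ a * (p : ℝ)⁻¹ ^ b) := by
    intro b
    have : {z | ‖u z‖ = (p : ℝ)⁻¹ ^ a ∧ ‖v z‖ ≤ (p : ℝ)⁻¹ ^ b} =
        {z | ‖u z‖ ≤ (p : ℝ)⁻¹ ^ a ∧ ‖v z‖ ≤ (p : ℝ)⁻¹ ^ b} \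
          {z | ‖u z‖ ≤ (p : ℝ)⁻¹ ^ (a + 1) ∧ ‖v z‖ ≤ (p : ℝ)⁻¹ ^ b} := by
      ext z
      simp only [Set.mem_ofPred_eq, Set.mem_sdiff, norm_eq_inv_pow_iff]
      tauto
    rw [this, measureReal_sdiff ?_ ?_ (hfin _ _), hbox, hbox]
    · ring
    · exact fun z hz => ⟨hz.1.trans (hpow a), hz.2⟩
    · exact (measurableSet_le hu measurable_const).inter (measurableSet_le hv measurable_const)
  have : {z | ‖u z‖ = (p : ℝ)⁻¹ ^ a ∧ ‖v z‖ = (p : ℝ)⁻¹ ^ b} =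
      {z | ‖u z‖ = (p : ℝ)⁻¹ ^ a ∧ ‖v z‖ ≤ (p : ℝ)⁻¹ ^ b} \
        {z | ‖u z‖ = (p : ℝ)⁻¹ ^ a ∧ ‖v z‖ ≤ (p : ℝ)⁻¹ ^ (b + 1)} := by
    ext z
    simp only [Set.mem_ofPred_eq, Set.mem_sdiff, norm_eq_inv_pow_iff (x := v z)]
    tauto
  rw [this, measureReal_sdiff ?_ ?_
    (ne_top_of_le_ne_top (hfin a b) (measure_mono fun z hz => ⟨hz.1.le, hz.2⟩)), hhalf, hhalf]
  · ring
  · exact fun z hz => ⟨hz.1, hz.2.trans (hpow b)⟩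
  · exact (measurableSet_eq_fun hu measurable_const).inter (measurableSet_le hv measurable_const)

theorem measure_ker_inter (u v : V →ₗ[ℚ_[p]] ℚ_[p]) (hu : Measurable fun z => ‖u z‖)
    (hv : Measurable fun z => ‖v z‖) {e₁ e₂ : V} (hue : u e₁ = 1) (hve : v e₁ = 0)
    (hue' : u e₂ = 0) (hve' : v e₂ = 1) (h1 : μ {z | ‖u z‖ ≤ 1 ∧ ‖v z‖ ≤ 1} = 1) :
    μ {z | u z = 0 ∧ ‖v z‖ ≤ 1} = 0 := by
  have hp1 : (1 : ℝ) < p := by exact_mod_cast hpp.out.one_lt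
  have hfin : μ {z | u z = 0 ∧ ‖v z‖ ≤ 1} ≠ ⊤ :=
    ne_top_of_le_ne_top (by rw [h1]; simp) (measure_mono (t := {z | ‖u z‖ ≤ 1 ∧ ‖v z‖ ≤ 1})
      fun z hz => ⟨by simp [hz.1], hz.2⟩)
  have hle : ∀ a : ℕ, μ.real {z | u z = 0 ∧ ‖v z‖ ≤ 1} ≤ (p : ℝ)⁻¹ ^ a := by
    intro a
    have hbox := measureReal_box (μ := μ) u v hu hv hue hve hue' hve' h1 a 0
    rw [pow_zero, mul_one] at hbox
    rw [← hbox]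
    refine measureReal_mono (fun z hz => ⟨by simp [hz.1], hz.2⟩) fun h => ?_
    rw [measureReal_def, h, ENNReal.toReal_top] at hbox
    exact (by positivity : (p : ℝ)⁻¹ ^ a ≠ 0) hbox.symm
  have h0 := ge_of_tendsto' (tendsto_pow_atTop_nhds_zero_of_lt_one (by positivity)
    (inv_lt_one_of_one_lt₀ hp1)) hle
  exact (measureReal_eq_zero_iff hfin).1 (le_antisymm h0 measureReal_nonneg)

theorem integral_cone (u v : V →ₗ[ℚ_[p]] ℚ_[p]) (hu : Measurable fun z => ‖u z‖)
    (hv : Measurable fun z => ‖v z‖) {e₁ e₂ : V} (hue : u e₁ = 1) (hve : v e₁ = 0)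
    (hue' : u e₂ = 0) (hve' : v e₂ = 1) (h1 : μ {z | ‖u z‖ ≤ 1 ∧ ‖v z‖ ≤ 1} = 1)
    {f : V → ℂ} {w : ℂ} (hw : ‖w‖ < p)
    (hf : ∀ z, ∀ m k : ℕ, ‖u z‖ = (p : ℝ)⁻¹ ^ (m + (k + 1)) → ‖v z‖ = (p : ℝ)⁻¹ ^ m →
      f z = w ^ (k + 1)) :
    IntegrableOn f {z | u z ≠ 0 ∧ ‖u z‖ < ‖v z‖ ∧ ‖v z‖ ≤ 1} μ ∧
      ∫ z in {z | u z ≠ 0 ∧ ‖u z‖ < ‖v z‖ ∧ ‖v z‖ ≤ 1}, f z ∂μ =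
        ((p : ℂ) - 1) / (p + 1) * (w / (p - w)) := by
  have hp1 : (1 : ℝ) < p := by exact_mod_cast hpp.out.one_lt
  have hq1 : (p : ℝ)⁻¹ < 1 := inv_lt_one_of_one_lt₀ hp1
  have hinj : Function.Injective fun n : ℕ => (p : ℝ)⁻¹ ^ n :=
    pow_right_injective₀ (by positivity) hq1.ne
  let S : ℕ × ℕ → Set V := fun i =>
    {z | ‖u z‖ = (p : ℝ)⁻¹ ^ (i.1 + (i.2 + 1)) ∧ ‖v z‖ = (p : ℝ)⁻¹ ^ i.1}
  have hSm : ∀ i, MeasurableSet (S i) := fun i =>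
    (measurableSet_eq_fun hu measurable_const).inter (measurableSet_eq_fun hv measurable_const)
  have hT : {z | u z ≠ 0 ∧ ‖u z‖ < ‖v z‖ ∧ ‖v z‖ ≤ 1} = ⋃ i, S i := by
    ext z
    simp only [Set.mem_ofPred_eq, Set.mem_iUnion, S, Prod.exists]
    constructor
    · rintro ⟨h0, hlt, hle⟩
      obtain ⟨m, hm⟩ := exists_norm_eq_inv_pow (norm_pos_iff.1 ((norm_nonneg _).trans_lt hlt)) hle
      obtain ⟨n, hn⟩ := exists_norm_eq_inv_pow h0 (hlt.le.trans hle)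
      rw [hm, hn] at hlt
      have hmn := (pow_lt_pow_iff_right_of_lt_one₀ (by positivity) hq1).1 hlt
      obtain ⟨k, rfl⟩ := Nat.exists_eq_add_of_lt hmn
      exact ⟨m, k, hn, hm⟩
    · rintro ⟨m, k, hn, hm⟩
      refine ⟨?_, ?_, ?_⟩
      · rw [← norm_pos_iff, hn]
        positivity
      · rw [hm, hn]
        exact pow_lt_pow_right_of_lt_one₀ (by positivity) hq1 (by omega)
      · rw [hm]
        exact pow_le_one₀ (by positivity) hq1.le
  have hdisj : Pairwise (Function.onFun Disjoint S) := by
    rintro ⟨m, k⟩ ⟨m', k'⟩ hne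
    refine Set.disjoint_left.2 fun z hz hz' => hne ?_
    have hm := hinj (hz.2.symm.trans hz'.2)
    have hn := hinj (hz.1.symm.trans hz'.1)
    simp only at hm hn
    ext <;> simp only <;> omega
  have hμS : ∀ i, μ.real (S i) = (1 - (p : ℝ)⁻¹) ^ 2 *
      ((p : ℝ)⁻¹ ^ (i.1 + (i.2 + 1)) * (p : ℝ)⁻¹ ^ i.1) := fun i =>
    measureReal_annulus (μ := μ) u v hu hv hue hve hue' hve' h1 _ _
  have hμS' : ∀ i, μ (S i) ≠ ⊤ := by
    intro i h
    have := hμS i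
    rw [measureReal_def, h, ENNReal.toReal_top] at this
    have h2 : (0 : ℝ) < 1 - (p : ℝ)⁻¹ := by linarith
    exact (by positivity : (1 - (p : ℝ)⁻¹) ^ 2 *
      ((p : ℝ)⁻¹ ^ (i.1 + (i.2 + 1)) * (p : ℝ)⁻¹ ^ i.1) ≠ 0) this.symm
  have hfS : ∀ i, Set.EqOn f (fun _ => w ^ (i.2 + 1)) (S i) := fun i z hz => hf z _ _ hz.1 hz.2
  have hpc : (p : ℂ) ≠ 0 := by exact_mod_cast hpp.out.ne_zero
  have hn1 : ‖((p : ℂ)⁻¹) ^ 2‖ < 1 := by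
    rw [norm_pow, norm_inv, Complex.norm_natCast]
    exact pow_lt_one₀ (by positivity) hq1 two_ne_zero
  have hn2 : ‖(p : ℂ)⁻¹ * w‖ < 1 := by
    rw [norm_mul, norm_inv, Complex.norm_natCast, inv_mul_lt_one₀ (by positivity)]
    exact hw
  have hsum : HasSum (fun i : ℕ × ℕ => (1 - (p : ℂ)⁻¹) ^ 2 * ((p : ℂ)⁻¹ * w) *
      ((((p : ℂ)⁻¹) ^ 2) ^ i.1 * ((p : ℂ)⁻¹ * w) ^ i.2))
      ((1 - (p : ℂ)⁻¹) ^ 2 * ((p : ℂ)⁻¹ * w) *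
        ((1 - ((p : ℂ)⁻¹) ^ 2)⁻¹ * (1 - (p : ℂ)⁻¹ * w)⁻¹)) :=
    ((hasSum_geometric_of_norm_lt_one hn1).mul (hasSum_geometric_of_norm_lt_one hn2)
      (summable_mul_of_summable_norm (summable_norm_geometric_of_norm_lt_one hn1)
        (summable_norm_geometric_of_norm_lt_one hn2))).mul_left _
  have hterm : ∀ i : ℕ × ℕ, μ.real (S i) • w ^ (i.2 + 1) =
      (1 - (p : ℂ)⁻¹) ^ 2 * ((p : ℂ)⁻¹ * w) *
        ((((p : ℂ)⁻¹) ^ 2) ^ i.1 * ((p : ℂ)⁻¹ * w) ^ i.2) := by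
    intro i
    rw [hμS, Complex.real_smul]
    push_cast
    ring
  have hint : IntegrableOn f (⋃ i, S i) μ := by
    refine integrableOn_iUnion_of_summable_integral_norm (fun i => ?_) ?_
    · exact (integrableOn_const (hμS' i)).congr_fun (hfS i).symm (hSm i)
    · refine hsum.summable.norm.congr fun i => ?_
      rw [setIntegral_congr_fun (hSm i) (fun z hz => congrArg norm (hfS i hz)), setIntegral_const,
        ← hterm, norm_smul, smul_eq_mul, Real.norm_of_nonneg measureReal_nonneg]
  rw [hT]
  refine ⟨hint, ?_⟩
  have h2 := hasSum_integral_iUnion hSm hdisj hint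
  have h3 : (fun i => ∫ z in S i, f z ∂μ) = fun i : ℕ × ℕ => (1 - (p : ℂ)⁻¹) ^ 2 *
      ((p : ℂ)⁻¹ * w) * ((((p : ℂ)⁻¹) ^ 2) ^ i.1 * ((p : ℂ)⁻¹ * w) ^ i.2) := by
    funext i
    rw [setIntegral_congr_fun (hSm i) (hfS i), setIntegral_const, hterm]
  rw [h3] at h2
  rw [h2.unique hsum]
  have hd1 : (p : ℂ) - w ≠ 0 := by
    rw [sub_ne_zero]
    rintro rfl
    simp at hw
  have hd2 : (p : ℂ) + 1 ≠ 0 := by exact_mod_cast p.succ_ne_zero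
  have hd3 : (p : ℂ) - 1 ≠ 0 := by
    rw [sub_ne_zero]
    exact_mod_cast hpp.out.one_lt.ne'
  have e1 : 1 - ((p : ℂ)⁻¹) ^ 2 = (p - 1) * (p + 1) / p ^ 2 := by
    field_simp
    ring
  have e2 : 1 - (p : ℂ)⁻¹ * w = (p - w) / p := by
    field_simp
  rw [e1, e2]
  field_simp

end Measure
section Integrand

variable {p : ℕ} [hpp : Fact p.Prime]

theorem norm_add_of_lt {a b : ℚ_[p]} (h : ‖a‖ < ‖b‖) : ‖a + b‖ = ‖b‖ := by
  rw [IsUltrametricDist.norm_add_eq_max_of_norm_ne_norm h.ne, max_eq_right h.le]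

theorem norm_sub_of_lt {a b : ℚ_[p]} (h : ‖a‖ < ‖b‖) : ‖a - b‖ = ‖b‖ := by
  rw [sub_eq_add_neg, norm_add_of_lt (by rwa [norm_neg]), norm_neg]

theorem norm_two_mul (hp : p ≠ 2) (x : ℚ_[p]) : ‖2 * x‖ = ‖x‖ := by
  have h : ‖((2 : ℕ) : ℚ_[p])‖ = 1 :=
    Padic.norm_natCast_eq_one_iff.2 ((Nat.coprime_primes hpp.out Nat.prime_two).2 hp)
  rw [norm_mul, ← Nat.cast_ofNat, h, one_mul]

theorem norm_add_of_norm_sub_lt (hp : p ≠ 2) {x y : ℚ_[p]} (h : ‖x - y‖ < ‖x‖) :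
    ‖x + y‖ = ‖x‖ := by
  have h' : ‖x - y‖ < ‖2 * x‖ := by rwa [norm_two_mul hp]
  rw [← norm_two_mul hp x, ← norm_sub_of_lt h', norm_sub_rev]
  congr 1
  ring

theorem norm_sub_of_norm_add_lt (hp : p ≠ 2) {x y : ℚ_[p]} (h : ‖x + y‖ < ‖x‖) :
    ‖x - y‖ = ‖x‖ := by
  have := norm_add_of_norm_sub_lt hp (x := x) (y := -y) (by rwa [sub_neg_eq_add])
  rwa [← sub_eq_add_neg] at this

theorem norm_quotient (x y : ℚ_[p]) :
    ‖(x ^ 2 - y ^ 2) / x ^ 2‖ = ‖x + y‖ * ‖x - y‖ / ‖x‖ ^ 2 := by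
  rw [norm_div, norm_pow, ← norm_mul, sq_sub_sq]

theorem natCast_pow_cpow (p n : ℕ) (s : ℂ) : (((p : ℝ) ^ n : ℝ) : ℂ) ^ s = ((p : ℂ) ^ s) ^ n := by
  push_cast
  rw [← Complex.natCast_cpow_natCast_mul, Complex.cpow_nat_mul]

theorem natCast_inv_pow_cpow (p n : ℕ) (s : ℂ) :
    ((((p : ℝ)⁻¹) ^ n : ℝ) : ℂ) ^ s = ((p : ℂ) ^ (-s)) ^ n := by
  rw [inv_pow, Complex.ofReal_inv, ← Nat.cast_pow, Complex.ofReal_natCast,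
    Complex.inv_cpow _ _ (by rw [Complex.natCast_arg]; exact Real.pi_pos.ne), ← Complex.cpow_neg,
    Nat.cast_pow, ← Complex.natCast_cpow_natCast_mul, Complex.cpow_nat_mul]

end Integrand

end PadicZeta

/-- Explicit local zeta function of `(x²−y²)/x²` on `ℤ_p²`, for odd `p`. -/
theorem padic_zeta_example_critical
    (p : ℕ) [Fact p.Prime] (hp : p ≠ 2)
    [MeasurableSpace (ℚ_[p] × ℚ_[p])] [BorelSpace (ℚ_[p] × ℚ_[p])]
    (μ : Measure (ℚ_[p] × ℚ_[p])) [μ.IsAddHaarMeasure]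
    (hμ : μ {z : ℚ_[p] × ℚ_[p] | ‖z.1‖ ≤ 1 ∧ ‖z.2‖ ≤ 1} = 1)
    (D : Set (ℚ_[p] × ℚ_[p]))
    (hD : D = {z : ℚ_[p] × ℚ_[p] | z.1 = 0 ∨ z.1 ^ 2 = z.2 ^ 2}) :
    ∀ s : ℂ, -1 < s.re → s.re < 1 / 2 →
      IntegrableOn
        (fun z : ℚ_[p] × ℚ_[p] =>
          ((‖(z.1 ^ 2 - z.2 ^ 2) / z.1 ^ 2‖ : ℝ) : ℂ) ^ s)
        ({z : ℚ_[p] × ℚ_[p] | ‖z.1‖ ≤ 1 ∧ ‖z.2‖ ≤ 1} \ D) μ ∧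
      ∫ z in ({z : ℚ_[p] × ℚ_[p] | ‖z.1‖ ≤ 1 ∧ ‖z.2‖ ≤ 1} \ D),
          ((‖(z.1 ^ 2 - z.2 ^ 2) / z.1 ^ 2‖ : ℝ) : ℂ) ^ s ∂μ =
        ((p : ℂ) ^ ((1 : ℂ) + s) + (p : ℂ) ^ 2 * ((p : ℂ) - 2) * (p : ℂ) ^ (-s) +
            (p : ℂ) ^ ((2 : ℂ) - 2 * s) - 2 * (p : ℂ) + 1) /
          (((p : ℂ) + 1) * ((p : ℂ) ^ ((1 : ℂ) + s) - 1) *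
            ((p : ℂ) ^ ((1 : ℂ) - 2 * s) - 1)) := by
  intro s hs1 hs2
  have hpp : p.Prime := Fact.out
  have hp1 : (1 : ℝ) < p := by exact_mod_cast hpp.one_lt
  have hp0 : (0 : ℝ) < p := by linarith
  have hpc : (p : ℂ) ≠ 0 := by exact_mod_cast hpp.ne_zero
  have hw₁ : ‖(p : ℂ) ^ (2 * s)‖ < p := by
    rw [Complex.norm_natCast_cpow_of_pos hpp.pos]
    exact (Real.rpow_lt_rpow_of_exponent_lt hp1 (by simp; linarith)).trans_eq (Real.rpow_one _)
  have hw₂ : ‖(p : ℂ) ^ (-s)‖ < p := by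
    rw [Complex.norm_natCast_cpow_of_pos hpp.pos]
    exact (Real.rpow_lt_rpow_of_exponent_lt hp1 (by simp; linarith)).trans_eq (Real.rpow_one _)
  have hw₀ : ‖(1 : ℂ)‖ < p := by simpa using hp1
  set F : ℚ_[p] × ℚ_[p] → ℂ := fun z => ((‖(z.1 ^ 2 - z.2 ^ 2) / z.1 ^ 2‖ : ℝ) : ℂ) ^ s with hF
  set B : Set (ℚ_[p] × ℚ_[p]) := {z | ‖z.1‖ ≤ 1 ∧ ‖z.2‖ ≤ 1} with hB
  let X := LinearMap.fst ℚ_[p] ℚ_[p] ℚ_[p]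
  let Y := LinearMap.snd ℚ_[p] ℚ_[p] ℚ_[p]
  have hXm : Measurable fun z => ‖X z‖ := (continuous_fst.norm).measurable
  have hYm : Measurable fun z => ‖Y z‖ := (continuous_snd.norm).measurable
  have hSm : Measurable fun z => ‖(X - Y) z‖ :=
    ((continuous_fst.sub continuous_snd).norm).measurable
  have hAm : Measurable fun z => ‖(X + Y) z‖ :=
    ((continuous_fst.add continuous_snd).norm).measurable
  have hBS : {z | ‖(X - Y) z‖ ≤ 1 ∧ ‖X z‖ ≤ 1} = B := by
    ext ⟨x, y⟩
    simp only [X, Y, hB, Set.mem_ofPred_eq, LinearMap.sub_apply, LinearMap.fst_apply,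
      LinearMap.snd_apply]
    constructor
    · rintro ⟨h1, h2⟩
      refine ⟨h2, ?_⟩
      rw [← sub_sub_cancel x y, sub_eq_add_neg]
      exact (IsUltrametricDist.norm_add_le_max _ _).trans (max_le h2 (by rwa [norm_neg]))
    · rintro ⟨h1, h2⟩
      refine ⟨?_, h1⟩
      rw [sub_eq_add_neg]
      exact (IsUltrametricDist.norm_add_le_max _ _).trans (max_le h1 (by rwa [norm_neg]))
  have hBA : {z | ‖(X + Y) z‖ ≤ 1 ∧ ‖X z‖ ≤ 1} = B := by
    ext ⟨x, y⟩
    simp only [X, Y, hB, Set.mem_ofPred_eq, LinearMap.add_apply, LinearMap.fst_apply,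
      LinearMap.snd_apply]
    constructor
    · rintro ⟨h1, h2⟩
      refine ⟨h2, ?_⟩
      rw [← add_sub_cancel_left x y, sub_eq_add_neg]
      exact (IsUltrametricDist.norm_add_le_max _ _).trans (max_le h1 (by rwa [norm_neg]))
    · rintro ⟨h1, h2⟩
      exact ⟨(IsUltrametricDist.norm_add_le_max _ _).trans (max_le h1 h2), h1⟩
  have hμS : μ {z | ‖(X - Y) z‖ ≤ 1 ∧ ‖X z‖ ≤ 1} = 1 := by rw [hBS, hμ]
  have hμA : μ {z | ‖(X + Y) z‖ ≤ 1 ∧ ‖X z‖ ≤ 1} = 1 := by rw [hBA, hμ]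
  have hC₁ : ∀ (f : ℚ_[p] × ℚ_[p] → ℂ) (w : ℂ) (hw : ‖w‖ < p), _ := fun f w hw =>
    PadicZeta.integral_cone (μ := μ) X Y hXm hYm (e₁ := (1, 0)) (e₂ := (0, 1))
      (by simp [X]) (by simp [Y]) (by simp [X]) (by simp [Y]) hμ (f := f) (w := w) hw
  have hC₂ : ∀ (f : ℚ_[p] × ℚ_[p] → ℂ) (w : ℂ) (hw : ‖w‖ < p), _ := fun f w hw =>
    PadicZeta.integral_cone (μ := μ) (X - Y) X hSm hXm (e₁ := (0, -1)) (e₂ := (1, 1))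
      (by simp [X, Y]) (by simp [X]) (by simp [X, Y]) (by simp [X]) hμS (f := f) (w := w) hw
  have hC₃ : ∀ (f : ℚ_[p] × ℚ_[p] → ℂ) (w : ℂ) (hw : ‖w‖ < p), _ := fun f w hw =>
    PadicZeta.integral_cone (μ := μ) (X + Y) X hAm hXm (e₁ := (0, 1)) (e₂ := (1, -1))
      (by simp [X, Y]) (by simp [X]) (by simp [X, Y]) (by simp [X]) hμA (f := f) (w := w) hw
  have hN₁ := PadicZeta.measure_ker_inter (μ := μ) X Y hXm hYm (e₁ := (1, 0)) (e₂ := (0, 1))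
    (by simp [X]) (by simp [Y]) (by simp [X]) (by simp [Y]) hμ
  have hN₂ := PadicZeta.measure_ker_inter (μ := μ) (X - Y) X hSm hXm (e₁ := (0, -1))
    (e₂ := (1, 1)) (by simp [X, Y]) (by simp [X]) (by simp [X, Y]) (by simp [X]) hμS
  have hN₃ := PadicZeta.measure_ker_inter (μ := μ) (X + Y) X hAm hXm (e₁ := (0, 1))
    (e₂ := (1, -1)) (by simp [X, Y]) (by simp [X]) (by simp [X, Y]) (by simp [X]) hμA
  set C₁ : Set (ℚ_[p] × ℚ_[p]) := {z | X z ≠ 0 ∧ ‖X z‖ < ‖Y z‖ ∧ ‖Y z‖ ≤ 1} with hC₁def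
  set C₂ : Set (ℚ_[p] × ℚ_[p]) :=
    {z | (X - Y) z ≠ 0 ∧ ‖(X - Y) z‖ < ‖X z‖ ∧ ‖X z‖ ≤ 1} with hC₂def
  set C₃ : Set (ℚ_[p] × ℚ_[p]) :=
    {z | (X + Y) z ≠ 0 ∧ ‖(X + Y) z‖ < ‖X z‖ ∧ ‖X z‖ ≤ 1} with hC₃def
  obtain ⟨i₁, v₁⟩ := hC₁ F _ hw₁ (by
    rintro ⟨x, y⟩ m k hx hy
    simp only [X, Y, LinearMap.fst_apply, LinearMap.snd_apply] at hx hy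
    have hlt : ‖x‖ < ‖y‖ := by
      rw [hx, hy]
      exact pow_lt_pow_right_of_lt_one₀ (by positivity) (inv_lt_one_of_one_lt₀ hp1) (by omega)
    have : ‖(x ^ 2 - y ^ 2) / x ^ 2‖ = (p : ℝ) ^ (2 * (k + 1)) := by
      rw [PadicZeta.norm_quotient, PadicZeta.norm_add_of_lt hlt, PadicZeta.norm_sub_of_lt hlt,
        hx, hy, inv_pow, inv_pow]
      field_simp
      ring
    simp only [hF, this]
    rw [PadicZeta.natCast_pow_cpow, pow_mul, ← Complex.cpow_nat_mul]
    norm_num)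
  obtain ⟨i₂, v₂⟩ := hC₂ F _ hw₂ (by
    rintro ⟨x, y⟩ m k hx hy
    simp only [X, Y, LinearMap.fst_apply, LinearMap.snd_apply, LinearMap.sub_apply] at hx hy
    have hlt : ‖x - y‖ < ‖x‖ := by
      rw [hx, hy]
      exact pow_lt_pow_right_of_lt_one₀ (by positivity) (inv_lt_one_of_one_lt₀ hp1) (by omega)
    have : ‖(x ^ 2 - y ^ 2) / x ^ 2‖ = (p : ℝ)⁻¹ ^ (k + 1) := by
      rw [PadicZeta.norm_quotient, PadicZeta.norm_add_of_norm_sub_lt hp hlt, hx, hy, pow_add]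
      field_simp
    simp only [hF, this]
    rw [PadicZeta.natCast_inv_pow_cpow])
  obtain ⟨i₃, v₃⟩ := hC₃ F _ hw₂ (by
    rintro ⟨x, y⟩ m k hx hy
    simp only [X, Y, LinearMap.fst_apply, LinearMap.snd_apply, LinearMap.add_apply] at hx hy
    have hlt : ‖x + y‖ < ‖x‖ := by
      rw [hx, hy]
      exact pow_lt_pow_right_of_lt_one₀ (by positivity) (inv_lt_one_of_one_lt₀ hp1) (by omega)
    have : ‖(x ^ 2 - y ^ 2) / x ^ 2‖ = (p : ℝ)⁻¹ ^ (k + 1) := by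
      rw [PadicZeta.norm_quotient, PadicZeta.norm_sub_of_norm_add_lt hp hlt, hx, hy, pow_add]
      field_simp
    simp only [hF, this]
    rw [PadicZeta.natCast_inv_pow_cpow])
  obtain ⟨j₁, u₁⟩ := hC₁ (fun _ => 1) 1 hw₀ (by simp)
  obtain ⟨j₂, u₂⟩ := hC₂ (fun _ => 1) 1 hw₀ (by simp)
  obtain ⟨j₃, u₃⟩ := hC₃ (fun _ => 1) 1 hw₀ (by simp)
  have hDm : MeasurableSet D := by
    rw [hD]
    exact ((isClosed_eq continuous_fst continuous_const).union
      (isClosed_eq (continuous_fst.pow 2) (continuous_snd.pow 2))).measurableSet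
  have hEm : MeasurableSet (B \ D) :=
    ((measurableSet_le hXm measurable_const).inter
      (measurableSet_le hYm measurable_const)).diff hDm
  have hcone : ∀ {u v : ℚ_[p] × ℚ_[p] →ₗ[ℚ_[p]] ℚ_[p]}, (Measurable fun z => ‖u z‖) →
      (Measurable fun z => ‖v z‖) → MeasurableSet {z | u z ≠ 0 ∧ ‖u z‖ < ‖v z‖ ∧ ‖v z‖ ≤ 1} := by
    intro u v hu hv
    have : {z | u z ≠ 0 ∧ ‖u z‖ < ‖v z‖ ∧ ‖v z‖ ≤ 1} =
        {z | 0 < ‖u z‖} ∩ ({z | ‖u z‖ < ‖v z‖} ∩ {z | ‖v z‖ ≤ 1}) := by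
      ext z
      simp
    rw [this]
    exact (measurableSet_lt measurable_const hu).inter
      ((measurableSet_lt hu hv).inter (measurableSet_le hv measurable_const))
  have hm₁ : MeasurableSet C₁ := hcone hXm hYm
  have hm₂ : MeasurableSet C₂ := hcone hSm hXm
  have hm₃ : MeasurableSet C₃ := hcone hAm hXm
  have d₁₂ : Disjoint C₁ C₂ := by
    refine Set.disjoint_left.2 fun ⟨x, y⟩ h h' => ?_
    simp only [X, Y, hC₁def, hC₂def, Set.mem_ofPred_eq, LinearMap.fst_apply, LinearMap.snd_apply,
      LinearMap.sub_apply] at h h'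
    have := PadicZeta.norm_sub_of_lt h.2.1
    linarith [h.2.1, h'.2.1]
  have d₁₃ : Disjoint C₁ C₃ := by
    refine Set.disjoint_left.2 fun ⟨x, y⟩ h h' => ?_
    simp only [X, Y, hC₁def, hC₃def, Set.mem_ofPred_eq, LinearMap.fst_apply, LinearMap.snd_apply,
      LinearMap.add_apply] at h h'
    have := PadicZeta.norm_add_of_lt h.2.1
    linarith [h.2.1, h'.2.1]
  have d₂₃ : Disjoint C₂ C₃ := by
    refine Set.disjoint_left.2 fun ⟨x, y⟩ h h' => ?_
    simp only [X, Y, hC₂def, hC₃def, Set.mem_ofPred_eq, LinearMap.fst_apply, LinearMap.snd_apply,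
      LinearMap.add_apply, LinearMap.sub_apply] at h h'
    have := PadicZeta.norm_add_of_norm_sub_lt hp h.2.1
    linarith [h'.2.1]
  have hKE : C₁ ∪ C₂ ∪ C₃ ⊆ B \ D := by
    rintro ⟨x, y⟩ h
    simp only [X, Y, hC₁def, hC₂def, hC₃def, Set.mem_ofPred_eq, LinearMap.fst_apply,
      LinearMap.snd_apply, LinearMap.add_apply, LinearMap.sub_apply, Set.mem_union] at h
    have key : x ≠ 0 → x - y ≠ 0 → x + y ≠ 0 → ‖x‖ ≤ 1 → ‖y‖ ≤ 1 → (x, y) ∈ B \ D := by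
      intro h1 h2 h3 h4 h5
      refine ⟨⟨h4, h5⟩, ?_⟩
      rw [hD]
      rintro (h | h)
      · exact h1 h
      · have h' : (x + y) * (x - y) = 0 := by
          rw [← sq_sub_sq]
          exact sub_eq_zero.2 h
        exact (mul_ne_zero h3 h2) h'
    rcases h with (⟨h1, h2, h3⟩ | ⟨h1, h2, h3⟩) | ⟨h1, h2, h3⟩
    · have hy := (norm_nonneg x).trans_lt h2
      refine key h1 ?_ ?_ (h2.le.trans h3) h3
      · rw [← norm_pos_iff, PadicZeta.norm_sub_of_lt h2]
        exact hy
      · rw [← norm_pos_iff, PadicZeta.norm_add_of_lt h2]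
        exact hy
    · have hx := (norm_nonneg _).trans_lt h2
      refine key (norm_pos_iff.1 hx) h1 ?_ h3 ?_
      · rw [← norm_pos_iff, PadicZeta.norm_add_of_norm_sub_lt hp h2]
        exact hx
      · exact ((Set.ext_iff.1 hBS (x, y)).1 ⟨h2.le.trans h3, h3⟩).2
    · have hx := (norm_nonneg _).trans_lt h2
      refine key (norm_pos_iff.1 hx) ?_ h1 h3 ?_
      · rw [← norm_pos_iff, PadicZeta.norm_sub_of_norm_add_lt hp h2]
        exact hx
      · exact ((Set.ext_iff.1 hBA (x, y)).1 ⟨h2.le.trans h3, h3⟩).2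
  have hone : ∀ z ∈ (B \ D) \ (C₁ ∪ C₂ ∪ C₃), F z = 1 := by
    rintro ⟨x, y⟩ ⟨⟨⟨hx, hy⟩, hnD⟩, hnK⟩
    rw [hD] at hnD
    simp only [Set.mem_ofPred_eq, not_or] at hnD hx hy
    obtain ⟨hx0, hne⟩ := hnD
    simp only [X, Y, hC₁def, hC₂def, hC₃def, Set.mem_ofPred_eq, LinearMap.fst_apply,
      LinearMap.snd_apply, LinearMap.add_apply, LinearMap.sub_apply, Set.mem_union, not_or,
      not_and, not_le] at hnK
    obtain ⟨⟨h1, h2⟩, h3⟩ := hnK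
    have hyx : ‖y‖ ≤ ‖x‖ := by
      by_contra! h
      exact absurd (h1 hx0 h) (not_lt.2 hy)
    have hs0 : x - y ≠ 0 := fun h => hne (by rw [sub_eq_zero.1 h])
    have ha0 : x + y ≠ 0 := fun h => hne (by rw [eq_neg_of_add_eq_zero_left h, neg_sq])
    have hs : ‖x - y‖ = ‖x‖ := by
      refine le_antisymm ?_ ?_
      · rw [sub_eq_add_neg]
        exact (IsUltrametricDist.norm_add_le_max _ _).trans (max_le le_rfl (by rwa [norm_neg]))
      · by_contra! h
        exact absurd (h2 hs0 h) (not_lt.2 hx)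
    have ha : ‖x + y‖ = ‖x‖ := by
      refine le_antisymm ?_ ?_
      · exact (IsUltrametricDist.norm_add_le_max _ _).trans (max_le le_rfl hyx)
      · by_contra! h
        exact absurd (h3 ha0 h) (not_lt.2 hx)
    have hxn : ‖x‖ ≠ 0 := norm_ne_zero_iff.2 hx0
    have : ‖(x ^ 2 - y ^ 2) / x ^ 2‖ = 1 := by
      rw [PadicZeta.norm_quotient, hs, ha]
      field_simp
    simp only [hF, this, Complex.ofReal_one, Complex.one_cpow]
  have hnull : μ (B ∩ D) = 0 := by
    refine measure_mono_null ?_ (measure_union_null (measure_union_null hN₁ hN₂) hN₃)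
    rintro ⟨x, y⟩ ⟨⟨hx, hy⟩, hd⟩
    rw [hD] at hd
    rcases hd with h | h
    · exact Or.inl (Or.inl ⟨h, hy⟩)
    · have h' : (x + y) * (x - y) = 0 := by
        rw [← sq_sub_sq]
        exact sub_eq_zero.2 h
      rcases mul_eq_zero.1 h' with h' | h'
      · exact Or.inr ⟨h', hx⟩
      · exact Or.inl (Or.inr ⟨h', hx⟩)
  have hμE : μ (B \ D) = 1 := by rw [measure_sdiff_null' hnull, hμ]
  have hiE1 : IntegrableOn (fun _ => (1 : ℂ)) (B \ D) μ :=
    integrableOn_const (by rw [hμE]; simp)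
  have hKm : MeasurableSet (C₁ ∪ C₂ ∪ C₃) := (hm₁.union hm₂).union hm₃
  have hiE : IntegrableOn F (B \ D) μ := by
    rw [← Set.union_sdiff_cancel hKE]
    refine ((i₁.union i₂).union i₃).union ?_
    exact (hiE1.mono_set Set.sdiff_subset).congr_fun (fun z hz => (hone z hz).symm)
      (hEm.diff hKm)
  refine ⟨hiE, ?_⟩
  have hsplit : ∫ z in B \ D, F z ∂μ = (∫ z in B \ D, (F z - 1) ∂μ) + 1 := by
    rw [integral_sub hiE hiE1, setIntegral_const, measureReal_def, hμE]
    simp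
  have k₁ : IntegrableOn (fun z => F z - 1) C₁ μ := i₁.sub j₁
  have k₂ : IntegrableOn (fun z => F z - 1) C₂ μ := i₂.sub j₂
  have k₃ : IntegrableOn (fun z => F z - 1) C₃ μ := i₃.sub j₃
  have hval : ∫ z in B \ D, (F z - 1) ∂μ =
      (∫ z in C₁, (F z - 1) ∂μ) + (∫ z in C₂, (F z - 1) ∂μ) + ∫ z in C₃, (F z - 1) ∂μ := by
    rw [setIntegral_eq_of_subset_of_forall_sdiff_eq_zero hEm hKE
      (fun z hz => by rw [hone z hz, sub_self]),
      setIntegral_union (d₁₃.union_left d₂₃) hm₃ (k₁.union k₂) k₃,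
      setIntegral_union d₁₂ hm₂ k₁ k₂]
  rw [hsplit, hval, integral_sub i₁ j₁, integral_sub i₂ j₂, integral_sub i₃ j₃, v₁, v₂, v₃,
    u₁, u₂, u₃]
  have n₁ : (p : ℂ) - (p : ℂ) ^ (2 * s) ≠ 0 := by
    intro h
    rw [← sub_eq_zero.1 h, Complex.norm_natCast] at hw₁
    exact lt_irrefl _ hw₁
  have n₂ : (p : ℂ) - (p : ℂ) ^ (-s) ≠ 0 := by
    intro h
    rw [← sub_eq_zero.1 h, Complex.norm_natCast] at hw₂
    exact lt_irrefl _ hw₂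
  have n₃ : (p : ℂ) + 1 ≠ 0 := by exact_mod_cast p.succ_ne_zero
  have n₄ : (p : ℂ) - 1 ≠ 0 := by
    rw [sub_ne_zero]
    exact_mod_cast hpp.one_lt.ne'
  have hP : (p : ℂ) ^ s ≠ 0 := by simp [Complex.cpow_eq_zero_iff, hpc]
  have e2 : (p : ℂ) ^ (2 * s) = ((p : ℂ) ^ s) ^ 2 := by
    rw [← Complex.cpow_nat_mul]
    norm_num
  have ep2 : (p : ℂ) ^ (2 : ℂ) = (p : ℂ) ^ 2 := by
    rw [← Complex.cpow_natCast]
    norm_num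
  rw [Complex.cpow_sub _ _ hpc, Complex.cpow_sub _ _ hpc, Complex.cpow_add _ _ hpc,
    Complex.cpow_one, ep2]
  rw [Complex.cpow_neg] at n₂ ⊢
  rw [e2] at n₁ ⊢
  set P := (p : ℂ) ^ s
  have n₂' : (p : ℂ) * P - 1 ≠ 0 := by
    intro h
    apply n₂
    field_simp
    rw [h, mul_zero]
  have f₁ : (p : ℂ) - P⁻¹ = (p * P - 1) / P := by field_simp
  have f₂ : (p : ℂ) / P ^ 2 - 1 = (p - P ^ 2) / P ^ 2 := by field_simp
  rw [f₁, f₂]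
  field_simp
  ring
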